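/- For n = 2 agents and m indivisible items partitioned into categories S_1,…,S_k with capacities s_1,…,s_k satisfying |S_h| ≤ 2·s_h for all h, and additive integer utilities u_1, u_2 (items may have positive or negative utilities), there exists a feasible allocation that is both Pareto-optimal and EF[1,1]. -/

import Mathlib

/-- Bundle of agent `i'` under allocation `A`. -/
def bundle {n m : ℕ} (A : Fin m → Fin n) (i' : Fin n) : Finset (Fin m) :=
  Finset.univ.filter (fun j => A j = i')

/-- Utility of agent `i` for the bundle of agent `i'` under allocation `A`. -/
def util {n m : ℕ} (u : Fin n → Fin m → ℤ) (A : Fin m → Fin n) (i i' : Fin n) : ℤ :=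
  ∑ j ∈ bundle A i', u i j

/-- An allocation is feasible if each agent gets at most `s h` items from category `h`. -/
def IsFeasible {n m k : ℕ} (cat : Fin m → Fin k) (s : Fin k → ℕ) (A : Fin m → Fin n) : Prop :=
  ∀ (i : Fin n) (h : Fin k), ((bundle A i).filter (fun j => cat j = h)).card ≤ s h

/-- A feasible allocation is Pareto-optimal if no feasible allocation Pareto-dominates it. -/
def IsParetoOptimal {n m k : ℕ} (u : Fin n → Fin m → ℤ) (cat : Fin m → Fin k)
    (s : Fin k → ℕ) (A : Fin m → Fin n) : Prop :=
  IsFeasible cat s A ∧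
    ¬ ∃ A' : Fin m → Fin n, IsFeasible cat s A' ∧
        (∀ i, util u A i i ≤ util u A' i i) ∧ (∃ i, util u A i i < util u A' i i)

/-- EF[1,1]: for every pair of agents `i, i'` there are sets `S ⊆ A_i` and `T ⊆ A_{i'}` of
size at most one with `u_i(A_i \ S) ≥ u_i(A_{i'} \ T)`. -/
def EF11 {n m : ℕ} (u : Fin n → Fin m → ℤ) (A : Fin m → Fin n) : Prop :=
  ∀ i i' : Fin n, ∃ S T : Finset (Fin m),
    S ⊆ bundle A i ∧ T ⊆ bundle A i' ∧ S.card ≤ 1 ∧ T.card ≤ 1 ∧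
      ∑ j ∈ bundle A i' \ T, u i j ≤ ∑ j ∈ bundle A i \ S, u i j

section TwoAgents

variable {m k : ℕ} {u : Fin 2 → Fin m → ℤ} {cat : Fin m → Fin k} {s : Fin k → ℕ}

/-- The allocation in which the two agents exchange their bundles. -/
def exchangeBundles (A : Fin m → Fin 2) : Fin m → Fin 2 := fun j => A j + 1

/-- `A` maximizes the utilitarian welfare with weights `a` and `b` among feasible allocations. -/
def IsWelfareMax (u : Fin 2 → Fin m → ℤ) (cat : Fin m → Fin k) (s : Fin k → ℕ) (a b : ℝ)
    (A : Fin m → Fin 2) : Prop :=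
  IsFeasible cat s A ∧ ∀ B, IsFeasible cat s B →
    a * util u B 0 0 + b * util u B 1 1 ≤ a * util u A 0 0 + b * util u A 1 1

lemma bundle_exchangeBundles (A : Fin m → Fin 2) (i : Fin 2) :
    bundle (exchangeBundles A) i = bundle A (i + 1) := by
  ext j
  simp only [bundle, Finset.mem_filter, Finset.mem_univ, true_and]
  unfold exchangeBundles
  generalize A j = x
  revert x i
  decide

lemma util_exchangeBundles (A : Fin m → Fin 2) (i i' : Fin 2) :
    util u (exchangeBundles A) i i' = util u A i (i' + 1) := by
  simp [util, bundle_exchangeBundles]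

lemma IsFeasible.exchangeBundles {A : Fin m → Fin 2} (hA : IsFeasible cat s A) :
    IsFeasible cat s (exchangeBundles A) := fun i h => by
  rw [bundle_exchangeBundles]
  exact hA (i + 1) h

lemma exists_isFeasible
    (hcap : ∀ h : Fin k, (Finset.univ.filter (fun j => cat j = h)).card ≤ 2 * s h) :
    ∃ A : Fin m → Fin 2, IsFeasible cat s A := by
  have hT : ∀ h, ∃ T ⊆ Finset.univ.filter (fun j => cat j = h),
      T.card = (Finset.univ.filter (fun j => cat j = h)).card / 2 := fun h =>
    Finset.exists_subset_card_eq (Nat.div_le_self _ _)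
  choose T hT hcard using hT
  refine ⟨fun j => if j ∈ T (cat j) then 0 else 1, fun i h => ?_⟩
  have h1 := hcap h
  have h2 := hcard h
  have h3 := Finset.card_sdiff_add_card_eq_card (hT h)
  fin_cases i
  · refine (Finset.card_le_card (t := T h) fun j hj => ?_).trans (by lia)
    simp [bundle] at hj
    exact hj.2 ▸ hj.1
  · refine (Finset.card_le_card
      (t := Finset.univ.filter (fun j => cat j = h) \ T h) fun j hj => ?_).trans (by lia)
    simp [bundle] at hj ⊢
    exact ⟨hj.2, hj.2 ▸ hj.1⟩

lemma IsFeasible.of_comp_perm {A B : Fin m → Fin 2} (hA : IsFeasible cat s A)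
    (e : Equiv.Perm (Fin m)) (hcat : ∀ j, cat (e j) = cat j) (hB : ∀ j, B j = A (e j)) :
    IsFeasible cat s B := fun i h => by
  refine le_of_eq_of_le (Finset.card_equiv e fun j => ?_) (hA i h)
  simp [bundle, hcat, hB]

/-- Two distinct feasible allocations can be brought closer to each other, within one category,
by a move or swap that keeps both of them feasible. -/
lemma exists_feasible_exchange {A B : Fin m → Fin 2} (hA : IsFeasible cat s A)
    (hB : IsFeasible cat s B) (hne : A ≠ B) :
    ∃ D : Finset (Fin m), D.Nonempty ∧ (∀ j ∈ D, A j ≠ B j) ∧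
      (∀ i, (bundle A i ∩ D).card ≤ 1) ∧
      IsFeasible cat s (D.piecewise B A) ∧ IsFeasible cat s (D.piecewise A B) := by
  obtain ⟨j, hj⟩ := Function.ne_iff.mp hne
  have htwo : ∀ x : Fin 2, x ≠ A j → x = B j := by
    generalize A j = p at hj
    generalize B j = q at hj
    revert p q
    decide
  by_cases hex : ∃ l, cat l = cat j ∧ A l = B j ∧ B l = A j
  · obtain ⟨l, hc, hAl, hBl⟩ := hex
    have hlj : l ≠ j := by rintro rfl; exact hj hAl
    refine ⟨{j, l}, by simp, ?_, ?_, ?_, ?_⟩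
    · simp only [Finset.mem_insert, Finset.mem_singleton]
      rintro x (rfl | rfl)
      · exact hj
      · rw [hAl, hBl]; exact hj.symm
    · intro i
      rw [Finset.card_le_one]
      simp only [bundle, Finset.mem_inter, Finset.mem_filter, Finset.mem_univ, true_and,
        Finset.mem_insert, Finset.mem_singleton]
      grind
    · refine hA.of_comp_perm (Equiv.swap j l) (fun x => ?_) (fun x => ?_)
      · grind
      · simp only [Finset.piecewise, Finset.mem_insert, Finset.mem_singleton]
        grind
    · refine hB.of_comp_perm (Equiv.swap j l) (fun x => ?_) (fun x => ?_)
      · grind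
      · simp only [Finset.piecewise, Finset.mem_insert, Finset.mem_singleton]
        grind
  · push Not at hex
    refine ⟨{j}, by simp, by simpa using hj, fun i =>
      (Finset.card_le_card Finset.inter_subset_right).trans (by simp), fun i h => ?_,
      fun i h => ?_⟩
    · by_cases hi : i = B j ∧ h = cat j
      · refine (Finset.card_le_card fun x hx => ?_).trans (hB i h)
        simp only [bundle, Finset.piecewise, Finset.mem_filter, Finset.mem_univ, true_and,
          Finset.mem_singleton] at hx ⊢
        grind
      · refine (Finset.card_le_card fun x hx => ?_).trans (hA i h)
        simp only [bundle, Finset.piecewise, Finset.mem_filter, Finset.mem_univ, true_and,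
          Finset.mem_singleton] at hx ⊢
        grind
    · by_cases hi : i = A j ∧ h = cat j
      · refine (Finset.card_le_card fun x hx => ?_).trans (hA i h)
        simp only [bundle, Finset.piecewise, Finset.mem_filter, Finset.mem_univ, true_and,
          Finset.mem_singleton] at hx ⊢
        grind
      · refine (Finset.card_le_card fun x hx => ?_).trans (hB i h)
        simp only [bundle, Finset.piecewise, Finset.mem_filter, Finset.mem_univ, true_and,
          Finset.mem_singleton] at hx ⊢
        grind

lemma util_piecewise_add_util_piecewise (A B : Fin m → Fin 2) (D : Finset (Fin m))
    (i i' : Fin 2) :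
    util u (D.piecewise B A) i i' + util u (D.piecewise A B) i i' =
      util u A i i' + util u B i i' := by
  simp only [util, bundle, Finset.sum_filter, ← Finset.sum_add_distrib]
  refine Finset.sum_congr rfl fun j _ => ?_
  by_cases hj : j ∈ D <;> simp [Finset.piecewise, hj, add_comm]

lemma IsWelfareMax.isParetoOptimal {a b : ℝ} (ha : 0 < a) (hb : 0 < b) {A : Fin m → Fin 2}
    (hA : IsWelfareMax u cat s a b A) : IsParetoOptimal u cat s A := by
  refine ⟨hA.1, ?_⟩
  rintro ⟨B, hB, hle, i, hi⟩
  have h := hA.2 B hB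
  have h0 : (util u A 0 0 : ℝ) ≤ util u B 0 0 := by exact_mod_cast hle 0
  have h1 : (util u A 1 1 : ℝ) ≤ util u B 1 1 := by exact_mod_cast hle 1
  have hi' : (util u A i i : ℝ) < util u B i i := by exact_mod_cast hi
  have h0' := mul_le_mul_of_nonneg_left h0 ha.le
  have h1' := mul_le_mul_of_nonneg_left h1 hb.le
  fin_cases i
  · have := mul_lt_mul_of_pos_left hi' ha
    simp at this
    linarith
  · have := mul_lt_mul_of_pos_left hi' hb
    simp at this
    linarith

lemma IsWelfareMax.piecewise {a b : ℝ} {A B : Fin m → Fin 2} {D : Finset (Fin m)}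
    (hA : IsWelfareMax u cat s a b A) (hB : IsWelfareMax u cat s a b B)
    (hD : IsFeasible cat s (D.piecewise B A)) (hD' : IsFeasible cat s (D.piecewise A B)) :
    IsWelfareMax u cat s a b (D.piecewise B A) := by
  refine ⟨hD, fun C hC => ?_⟩
  have hBC := hB.2 _ hD'
  have hAC := hA.2 C hC
  have h0 : (util u (D.piecewise B A) 0 0 + util u (D.piecewise A B) 0 0 : ℝ) =
      util u A 0 0 + util u B 0 0 := by
    exact_mod_cast util_piecewise_add_util_piecewise A B D 0 0
  have h1 : (util u (D.piecewise B A) 1 1 + util u (D.piecewise A B) 1 1 : ℝ) =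
      util u A 1 1 + util u B 1 1 := by
    exact_mod_cast util_piecewise_add_util_piecewise A B D 1 1
  linear_combination hAC + hBC - a * h0 - b * h1

/-- In a Pareto-optimal allocation some agent does not envy the other. -/
lemma IsParetoOptimal.not_envy_one_of_envy_zero {A : Fin m → Fin 2}
    (hA : IsParetoOptimal u cat s A) (h0 : util u A 0 0 < util u A 0 1) :
    util u A 1 0 ≤ util u A 1 1 := by
  by_contra! h1
  refine hA.2 ⟨exchangeBundles A, hA.1.exchangeBundles, ?_, 0, ?_⟩
  · simp only [util_exchangeBundles, Fin.forall_fin_two]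
    exact ⟨h0.le, h1.le⟩
  · simpa [util_exchangeBundles] using h0

lemma ef11_of_sdiff {A : Fin m → Fin 2} {D E : Finset (Fin m)}
    (hD : ∀ i, (bundle A i ∩ D).card ≤ 1) (hE : ∀ i, (bundle A i ∩ E).card ≤ 1)
    (h0 : ∑ j ∈ bundle A 1 \ D, u 0 j ≤ ∑ j ∈ bundle A 0 \ D, u 0 j)
    (h1 : ∑ j ∈ bundle A 0 \ E, u 1 j ≤ ∑ j ∈ bundle A 1 \ E, u 1 j) : EF11 u A := by
  intro i i'
  by_cases hii : i = i'
  · subst hii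
    exact ⟨∅, ∅, by simp, by simp, by simp, by simp, le_rfl⟩
  fin_cases i <;> fin_cases i'
  · exact absurd rfl hii
  · exact ⟨bundle A 0 ∩ D, bundle A 1 ∩ D, Finset.inter_subset_left, Finset.inter_subset_left,
      hD 0, hD 1, by simpa using h0⟩
  · exact ⟨bundle A 1 ∩ E, bundle A 0 ∩ E, Finset.inter_subset_left, Finset.inter_subset_left,
      hE 1, hE 0, by simpa using h1⟩
  · exact absurd rfl hii

lemma ef11_of_not_envy {A : Fin m → Fin 2} (h0 : util u A 0 1 ≤ util u A 0 0)
    (h1 : util u A 1 0 ≤ util u A 1 1) : EF11 u A :=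
  ef11_of_sdiff (D := ∅) (E := ∅) (by simp) (by simp) (by simpa [util] using h0)
    (by simpa [util] using h1)

/-- If moving or swapping the items of `D` makes the first agent envious, one of the two
Pareto-optimal allocations before and after the change is EF[1,1]. -/
lemma ef11_or_ef11_of_exchange {A B : Fin m → Fin 2} {D : Finset (Fin m)}
    (hA : IsParetoOptimal u cat s A) (hB : IsParetoOptimal u cat s B)
    (hD : ∀ j ∈ D, A j ≠ B j) (hD' : ∀ j ∉ D, A j = B j)
    (hcard : ∀ i, (bundle A i ∩ D).card ≤ 1)
    (hA0 : util u A 0 1 ≤ util u A 0 0) (hB0 : util u B 0 0 < util u B 0 1) :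
    EF11 u A ∨ EF11 u B := by
  have hin : ∀ i, bundle B (i + 1) ∩ D = bundle A i ∩ D := fun i => by
    ext j
    simp only [bundle, Finset.mem_inter, Finset.mem_filter, Finset.mem_univ, true_and]
    refine and_congr_left fun hj => ?_
    have := hD j hj
    generalize A j = x at this
    generalize B j = y at this
    revert x y i
    decide
  have hout : ∀ i, bundle B i \ D = bundle A i \ D := fun i => by
    ext j
    simp only [bundle, Finset.mem_sdiff, Finset.mem_filter, Finset.mem_univ, true_and]
    exact and_congr_left fun hj => by rw [hD' j hj]
  have hsplit : ∀ i i' (C : Fin m → Fin 2), util u C i i' =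
      ∑ j ∈ bundle C i' ∩ D, u i j + ∑ j ∈ bundle C i' \ D, u i j := fun i i' C =>
    (Finset.sum_inter_add_sum_sdiff _ _ _).symm
  by_cases h1 : ∑ j ∈ bundle A 0 \ D, u 1 j ≤ ∑ j ∈ bundle A 1 \ D, u 1 j
  · exact .inl (ef11_of_sdiff (D := ∅) (by simp) hcard (by simpa [util] using hA0) h1)
  by_cases h0 : ∑ j ∈ bundle A 1 \ D, u 0 j ≤ ∑ j ∈ bundle A 0 \ D, u 0 j
  · refine .inr (ef11_of_sdiff (D := D) (E := ∅) (fun i => ?_) (by simp) ?_ ?_)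
    · have := hin (i + 1)
      rw [show i + 1 + 1 = i by fin_cases i <;> rfl] at this
      exact this ▸ hcard (i + 1)
    · rwa [hout, hout]
    · simpa [util] using hB.not_envy_one_of_envy_zero hB0
  · exfalso
    push Not at h0 h1
    have e0 : util u A 0 0 < util u (exchangeBundles B) 0 0 := by
      rw [util_exchangeBundles, hsplit 0 0 A, hsplit 0 _ B, hin, hout]
      exact add_lt_add_right h0 _
    have e1 : util u A 1 1 < util u (exchangeBundles B) 1 1 := by
      rw [util_exchangeBundles, hsplit 1 1 A, hsplit 1 _ B, hin, hout]
      exact add_lt_add_right h1 _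
    refine hA.2 ⟨exchangeBundles B, hB.1.exchangeBundles, ?_, 0, e0⟩
    rw [Fin.forall_fin_two]
    exact ⟨e0.le, e1.le⟩

/-- If two welfare maximizers for the same positive weights differ in whether the first agent is
envious, then some Pareto-optimal allocation is EF[1,1]. -/
lemma exists_ef11_of_isWelfareMax {a b : ℝ} (ha : 0 < a) (hb : 0 < b) {A B : Fin m → Fin 2}
    (hA : IsWelfareMax u cat s a b A) (hB : IsWelfareMax u cat s a b B)
    (hA0 : util u A 0 1 ≤ util u A 0 0) (hB0 : util u B 0 0 < util u B 0 1) :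
    ∃ C : Fin m → Fin 2, IsParetoOptimal u cat s C ∧ EF11 u C := by
  induction hn : (Finset.univ.filter fun j => A j ≠ B j).card using Nat.strong_induction_on
    generalizing A with
  | _ n ih =>
    have hne : A ≠ B := by rintro rfl; exact hA0.not_gt hB0
    obtain ⟨D, ⟨d, hd⟩, hD, hcard, hfeas, hfeas'⟩ := exists_feasible_exchange hA.1 hB.1 hne
    have hC := hA.piecewise hB hfeas hfeas'
    rcases le_or_gt (util u (D.piecewise B A) 0 1) (util u (D.piecewise B A) 0 0) with h | h
    · refine ih _ ?_ hC h rfl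
      rw [← hn]
      refine Finset.card_lt_card (Finset.ssubset_iff_of_subset (fun j hj => ?_) |>.mpr
        ⟨d, by simpa using hD d hd, by simp [hd]⟩)
      by_cases hjD : j ∈ D
      · simpa using hD j hjD
      · simpa [hjD] using hj
    · have hPA := hA.isParetoOptimal ha hb
      have hPC := hC.isParetoOptimal ha hb
      rcases ef11_or_ef11_of_exchange hPA hPC (D := D) (fun j hj => by simpa [hj] using hD j hj)
        (fun j hj => by simp [hj]) hcard hA0 h with hE | hE
      · exact ⟨A, hPA, hE⟩
      · exact ⟨_, hPC, hE⟩

lemma exists_isWelfareMax {F : Fin m → Fin 2} (hF : IsFeasible cat s F) (a b : ℝ) :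
    ∃ A, IsWelfareMax u cat s a b A := by
  classical
  obtain ⟨A, hA, hmax⟩ := Finset.exists_max_image
    (Finset.univ.filter fun A : Fin m → Fin 2 => IsFeasible cat s A)
    (fun A => a * util u A 0 0 + b * util u A 1 1) ⟨F, by simpa using hF⟩
  exact ⟨A, by simpa using hA, fun B hB => hmax B (by simpa using hB)⟩

lemma abs_util_sub_util_le (A : Fin m → Fin 2) (i : Fin 2) :
    |util u A i 0 - util u A i 1| ≤ ∑ j, |u i j| := by
  have : util u A i 0 - util u A i 1 = ∑ j, if A j = 0 then u i j else - u i j := by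
    simp only [util, bundle, Finset.sum_filter, ← Finset.sum_sub_distrib]
    refine Finset.sum_congr rfl fun j _ => ?_
    generalize A j = x
    fin_cases x <;> simp
  rw [this]
  refine (Finset.abs_sum_le_sum_abs _ _).trans (Finset.sum_le_sum fun j _ => ?_)
  split_ifs <;> simp

/-- An agent whose weight is large enough does not envy the other one in a welfare maximizer. -/
lemma IsWelfareMax.not_envy_zero {a : ℝ} (ha : (∑ j, |u 1 j| : ℤ) < a) {A : Fin m → Fin 2}
    (hA : IsWelfareMax u cat s a 1 A) : util u A 0 1 ≤ util u A 0 0 := by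
  by_contra! h
  have hmax := hA.2 _ hA.1.exchangeBundles
  simp only [util_exchangeBundles] at hmax
  rw [show (0 + 1 : Fin 2) = 1 from rfl, show (1 + 1 : Fin 2) = 0 from rfl] at hmax
  have habs : (util u A 1 1 - util u A 1 0 : ℝ) ≤ (∑ j, |u 1 j| : ℤ) := by
    exact_mod_cast (le_abs_self _).trans (abs_sub_comm (util u A 1 1) _ ▸ abs_util_sub_util_le A 1)
  have hpos : (0 : ℝ) ≤ (∑ j, |u 1 j| : ℤ) := by
    exact_mod_cast Finset.sum_nonneg fun j _ => abs_nonneg (u 1 j)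
  have h' : (util u A 0 0 : ℝ) + 1 ≤ util u A 0 1 := by exact_mod_cast h
  nlinarith

lemma IsWelfareMax.not_envy_one {b : ℝ} (hb : (∑ j, |u 0 j| : ℤ) < b) {A : Fin m → Fin 2}
    (hA : IsWelfareMax u cat s 1 b A) : util u A 1 0 ≤ util u A 1 1 := by
  by_contra! h
  have hmax := hA.2 _ hA.1.exchangeBundles
  simp only [util_exchangeBundles] at hmax
  rw [show (0 + 1 : Fin 2) = 1 from rfl, show (1 + 1 : Fin 2) = 0 from rfl] at hmax
  have habs : (util u A 0 0 - util u A 0 1 : ℝ) ≤ (∑ j, |u 0 j| : ℤ) := by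
    exact_mod_cast (le_abs_self _).trans (abs_util_sub_util_le A 0)
  have hpos : (0 : ℝ) ≤ (∑ j, |u 0 j| : ℤ) := by
    exact_mod_cast Finset.sum_nonneg fun j _ => abs_nonneg (u 0 j)
  have h' : (util u A 1 1 : ℝ) + 1 ≤ util u A 1 0 := by exact_mod_cast h
  nlinarith

/-- If allocations with and without a property are optimal at opposite ends of a segment of
weights, then at some point of the segment both kinds are optimal. -/
lemma exists_isWelfareMax_pair (P : (Fin m → Fin 2) → Prop) {M : ℝ} (hM : 1 ≤ M)
    {A B : Fin m → Fin 2} (hA : IsWelfareMax u cat s M 1 A) (hB : IsWelfareMax u cat s 1 M B)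
    (hPA : P A) (hPB : ¬ P B) :
    ∃ a b : ℝ, 0 < a ∧ 0 < b ∧ ∃ A' B', IsWelfareMax u cat s a b A' ∧
      IsWelfareMax u cat s a b B' ∧ P A' ∧ ¬ P B' := by
  classical
  let W : (Fin m → Fin 2) → ℝ → ℝ := fun C t => t * util u C 0 0 + (M + 1 - t) * util u C 1 1
  let X := Finset.univ.filter fun C : Fin m → Fin 2 => IsFeasible cat s C ∧ P C
  let Y := Finset.univ.filter fun C : Fin m → Fin 2 => IsFeasible cat s C ∧ ¬ P C
  have hAX : A ∈ X := by simp [X, hA.1, hPA]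
  have hBY : B ∈ Y := by simp [Y, hB.1, hPB]
  have hX : X.Nonempty := ⟨A, hAX⟩
  have hY : Y.Nonempty := ⟨B, hBY⟩
  have hW : ∀ C, Continuous (W C) := fun C => by fun_prop
  have hcX : Continuous fun t => X.sup' hX fun C => W C t :=
    Continuous.finset_sup'_apply hX fun C _ => hW C
  have hcY : Continuous fun t => Y.sup' hY fun C => W C t :=
    Continuous.finset_sup'_apply hY fun C _ => hW C
  obtain ⟨t, ht, heq⟩ := isPreconnected_Icc.intermediate_value₂ (Set.left_mem_Icc.mpr hM)
    (Set.right_mem_Icc.mpr hM) hcX.continuousOn hcY.continuousOn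
    (Finset.sup'_le _ _ fun C hC => by
      refine le_trans ?_ (Finset.le_sup' (fun C => W C 1) hBY)
      simpa [W] using hB.2 C (Finset.mem_filter.mp hC).2.1)
    (Finset.sup'_le _ _ fun C hC => by
      refine le_trans ?_ (Finset.le_sup' (fun C => W C M) hAX)
      simpa [W] using hA.2 C (Finset.mem_filter.mp hC).2.1)
  obtain ⟨A', hA', hAt⟩ := Finset.exists_mem_eq_sup' hX fun C => W C t
  obtain ⟨B', hB', hBt⟩ := Finset.exists_mem_eq_sup' hY fun C => W C t
  have hAB : W A' t = W B' t := by rw [← hAt, ← hBt]; exact heq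
  have hmax : ∀ C, IsFeasible cat s C → W C t ≤ W A' t := fun C hC => by
    by_cases hP : P C
    · rw [← hAt]
      exact Finset.le_sup' (fun C => W C t) (by simp [X, hC, hP])
    · rw [hAB, ← hBt]
      exact Finset.le_sup' (fun C => W C t) (by simp [Y, hC, hP])
  have hA'X := (Finset.mem_filter.mp hA').2
  have hB'Y := (Finset.mem_filter.mp hB').2
  exact ⟨t, M + 1 - t, by linarith [ht.1], by linarith [ht.2], A', B', ⟨hA'X.1, hmax⟩,
    ⟨hB'Y.1, fun C hC => (hmax C hC).trans_eq hAB⟩, hA'X.2, hB'Y.2⟩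

end TwoAgents

/-- For two agents with additive integer utilities and category constraints, there is a
feasible allocation that is both Pareto-optimal and EF[1,1]. -/
theorem statement1 (m k : ℕ) (u : Fin 2 → Fin m → ℤ) (cat : Fin m → Fin k) (s : Fin k → ℕ)
    (hcap : ∀ h : Fin k, (Finset.univ.filter (fun j => cat j = h)).card ≤ 2 * s h) :
    ∃ A : Fin m → Fin 2, IsParetoOptimal u cat s A ∧ EF11 u A := by
  obtain ⟨F, hF⟩ := exists_isFeasible hcap
  obtain ⟨M, hM1, hM⟩ : ∃ M : ℝ, 1 ≤ M ∧ ∀ i, ((∑ j, |u i j| : ℤ) : ℝ) < M := by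
    have hnonneg : ∀ i, (0 : ℝ) ≤ (∑ j, |u i j| : ℤ) := fun i => by
      exact_mod_cast Finset.sum_nonneg fun j _ => abs_nonneg (u i j)
    refine ⟨(∑ j, |u 0 j| : ℤ) + (∑ j, |u 1 j| : ℤ) + 1,
      by linarith [hnonneg 0, hnonneg 1], ?_⟩
    rw [Fin.forall_fin_two]
    constructor <;> linarith [hnonneg 0, hnonneg 1]
  obtain ⟨A, hA⟩ := exists_isWelfareMax (u := u) hF M 1
  obtain ⟨B, hB⟩ := exists_isWelfareMax (u := u) hF 1 M
  by_cases hB0 : util u B 0 1 ≤ util u B 0 0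
  · exact ⟨B, hB.isParetoOptimal one_pos (by linarith),
      ef11_of_not_envy hB0 (hB.not_envy_one (hM 0))⟩
  · obtain ⟨a, b, ha, hb, A', B', hA', hB', hP, hQ⟩ :=
      exists_isWelfareMax_pair (fun C => util u C 0 1 ≤ util u C 0 0) hM1 hA hB
        (hA.not_envy_zero (hM 1)) hB0
    exact exists_ef11_of_isWelfareMax ha hb hA' hB' hP (not_le.mp hQ)
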